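/- arXiv:cond-mat/0703199 — 2 statements merged into one kernel-verified Lean document; each statement's English description precedes it below -/
import Mathlib

section
/- For β > 0 and J > 0, the quantity e_TR^0(β) = −(3/2)J·[(e^{2βJ}−e^{−2βJ})/(e^{2βJ}+3e^{−2βJ}) + (e^{2βJ}−e^{−2βJ})/(3e^{2βJ}+e^{−2βJ})] satisfies e_TR^0(β) ≥ −3J tanh(βJ). -/
open Finset Real

/-- Spin value of a Boolean spin variable: `true ↦ 1`, `false ↦ -1`. -/
def spin (b : Bool) : ℝ := if b then 1 else -1

/-- Energy of a finite Ising system: `H(S) = -∑_{A ⊆ V} J_A ∏_{i ∈ A} S_i`. -/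
noncomputable def energy {V : Type*} [Fintype V] [DecidableEq V]
    (J : Finset V → ℝ) (S : V → Bool) : ℝ :=
  -∑ A : Finset V, J A * ∏ i ∈ A, spin (S i)

/-- Partition function `Z(β, J) = ∑_S exp (-β H(S))`. -/
noncomputable def Z {V : Type*} [Fintype V] [DecidableEq V]
    (β : ℝ) (J : Finset V → ℝ) : ℝ :=
  ∑ S : V → Bool, Real.exp (-β * energy J S)

/-- Thermal average `⟨f⟩_β = Z⁻¹ ∑_S f(S) exp (-β H(S))`. -/
noncomputable def texp {V : Type*} [Fintype V] [DecidableEq V]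
    (β : ℝ) (J : Finset V → ℝ) (f : (V → Bool) → ℝ) : ℝ :=
  (∑ S : V → Bool, f S * Real.exp (-β * energy J S)) / Z β J

/-- Thermal average of the local energy of subset `A`:
`e_A(β, J_A) = -⟨J_A ∏_{i ∈ A} S_i⟩_β`. -/
noncomputable def eA {V : Type*} [Fintype V] [DecidableEq V]
    (β : ℝ) (J : Finset V → ℝ) (A : Finset V) : ℝ :=
  texp β J (fun S => -(J A * ∏ i ∈ A, spin (S i)))

/-- Deviation of the local energy from its isolated value:
`Δ(β, J_A) = e_A(β, J_A) + J_A tanh (β J_A)`. -/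
noncomputable def Δ {V : Type*} [Fintype V] [DecidableEq V]
    (β : ℝ) (J : Finset V → ℝ) (A : Finset V) : ℝ :=
  eA β J A + J A * Real.tanh (β * J A)

/-- Couplings with the single coupling `J_A` negated. -/
noncomputable def flipJ {V : Type*} [DecidableEq V]
    (J : Finset V → ℝ) (A : Finset V) : Finset V → ℝ :=
  Function.update J A (-(J A))

/-- `e_TR^0(β) ≥ -3 J tanh(β J)`. -/
theorem triangle_reference_energy_bound (β J0 : ℝ) (hβ : 0 < β) (hJ : 0 < J0) :
    -(3 / 2) * J0 *
        ((Real.exp (2 * β * J0) - Real.exp (-(2 * β * J0))) /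
            (Real.exp (2 * β * J0) + 3 * Real.exp (-(2 * β * J0))) +
          (Real.exp (2 * β * J0) - Real.exp (-(2 * β * J0))) /
            (3 * Real.exp (2 * β * J0) + Real.exp (-(2 * β * J0)))) ≥
      -3 * J0 * Real.tanh (β * J0) := by
  have hs : 0 < β * J0 := mul_pos hβ hJ
  have hx1 : 1 < Real.exp (2 * β * J0) := Real.one_lt_exp_iff.mpr (by linarith)
  have ht : Real.tanh (β * J0) =
      (Real.exp (2 * β * J0) - 1) / (Real.exp (2 * β * J0) + 1) := by
    have h2 : Real.exp (2 * β * J0) = Real.exp (β * J0) * Real.exp (β * J0) := by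
      rw [← Real.exp_add]; congr 1; ring
    rw [Real.tanh_eq_sinh_div_cosh, Real.sinh_eq, Real.cosh_eq, h2, Real.exp_neg]
    have := Real.exp_pos (β * J0)
    field_simp
  rw [ht, Real.exp_neg]
  generalize Real.exp (2 * β * J0) = x at hx1
  have hx : 0 < x := by linarith
  have key : 2 * ((x - 1) / (x + 1)) - ((x - x⁻¹) / (x + 3 * x⁻¹) + (x - x⁻¹) / (3 * x + x⁻¹))
      = 2 * (x - 1) ^ 5 / ((x + 1) * (x ^ 2 + 3) * (3 * x ^ 2 + 1)) := by
    have e1 : (x - x⁻¹) / (x + 3 * x⁻¹) = (x ^ 2 - 1) / (x ^ 2 + 3) := by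
      field_simp
    have e2 : (x - x⁻¹) / (3 * x + x⁻¹) = (x ^ 2 - 1) / (3 * x ^ 2 + 1) := by
      field_simp
    rw [e1, e2]
    field_simp
    ring
  have hnn : 0 ≤ 2 * (x - 1) ^ 5 / ((x + 1) * (x ^ 2 + 3) * (3 * x ^ 2 + 1)) := by
    have : 0 < x - 1 := by linarith
    positivity
  rw [← key] at hnn
  nlinarith [mul_nonneg hJ.le hnn]
end

section
/- Combining the two previous bounds: if a triangle of Ising spins sits inside an arbitrary finite Ising system and its three two-body couplings are i.i.d. symmetric ±J random variables, then the average triangle energy satisfies E[e_TR(β)] ≥ −(3/2)J·[(e^{2βJ}−e^{−2βJ})/(e^{2βJ}+3e^{−2βJ}) + (e^{2βJ}−e^{−2βJ})/(3e^{2βJ}+e^{−2βJ})], which is an improvement over the bound −3J tanh(βJ) from the general theorem. -/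
open Finset Real

theorem aux_unfr (A B p q : ℝ) (hB : 0 < B) (hAB : B ≤ A) (hp : 0 ≤ p) (hq : 0 ≤ q)
    (hP : 0 < p + q) :
    (3 * p * A - q * B) / (p * A + q * B) ≤
      3 * ((A - B) / (A + 3 * B)) + 16 * A * B / (A + 3 * B) ^ 2 * ((3 * p - q) / (p + q)) := by
  have hA : 0 < A := lt_of_lt_of_le hB hAB
  have hD : 0 < p * A + q * B := by nlinarith [mul_nonneg hp (sub_nonneg.2 hAB), mul_pos hP hB]
  have hE : 0 < A + 3 * B := by positivity
  have key : 3 * ((A - B) / (A + 3 * B)) + 16 * A * B / (A + 3 * B) ^ 2 * ((3 * p - q) / (p + q))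
      - (3 * p * A - q * B) / (p * A + q * B) =
      4 * A * B * (3 * p - q) ^ 2 * (A - B) / ((p * A + q * B) * (A + 3 * B) ^ 2 * (p + q)) := by
    obtain ⟨d, hd⟩ : ∃ d, d = p * A + q * B := ⟨_, rfl⟩
    rw [← hd] at hD ⊢
    field_simp
    rw [hd]
    ring
  have : 0 ≤ 4 * A * B * (3 * p - q) ^ 2 * (A - B) /
      ((p * A + q * B) * (A + 3 * B) ^ 2 * (p + q)) := by
    have := sub_nonneg.2 hAB
    positivity
  linarith

theorem aux_fr (C D p q : ℝ) (hC : 0 < C) (hCD : C ≤ D) (hp : 0 ≤ p) (hq : 0 ≤ q)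
    (hP : 0 < p + q) :
    (-3 * p * C + q * D) / (p * C + q * D) ≤
      3 * ((D - C) / (3 * D + C)) - 16 * C * D / (3 * D + C) ^ 2 * ((3 * p - q) / (p + q)) := by
  have hA : 0 < D := lt_of_lt_of_le hC hCD
  have hD : 0 < p * C + q * D := by nlinarith [mul_nonneg hq (sub_nonneg.2 hCD), mul_pos hP hC]
  have hE : 0 < 3 * D + C := by positivity
  have key : 3 * ((D - C) / (3 * D + C)) - 16 * C * D / (3 * D + C) ^ 2 * ((3 * p - q) / (p + q))
      - (-3 * p * C + q * D) / (p * C + q * D) =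
      4 * C * D * (3 * p - q) ^ 2 * (D - C) / ((p * C + q * D) * (3 * D + C) ^ 2 * (p + q)) := by
    obtain ⟨d, hd⟩ : ∃ d, d = p * C + q * D := ⟨_, rfl⟩
    rw [← hd] at hD ⊢
    field_simp
    rw [hd]
    ring
  have : 0 ≤ 4 * C * D * (3 * p - q) ^ 2 * (D - C) /
      ((p * C + q * D) * (3 * D + C) ^ 2 * (p + q)) := by
    have := sub_nonneg.2 hCD
    positivity
  linarith

theorem aux_sum8 (f : (Fin 3 → Bool) → ℝ) : ∑ ε, f ε =
    f ![true, true, true] + f ![true, false, false] + f ![false, true, false]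
    + f ![false, false, true] + f ![false, false, false] + f ![false, true, true]
    + f ![true, false, true] + f ![true, true, false] := by
  have h : (Finset.univ : Finset (Fin 3 → Bool)) =
      {![true, true, true], ![true, false, false], ![false, true, false],
        ![false, false, true], ![false, false, false], ![false, true, true],
        ![true, false, true], ![true, true, false]} := by decide
  rw [h]
  repeat rw [Finset.sum_insert (by decide)]
  rw [Finset.sum_singleton]
  ring

/-- Final averaging step for the eight configurations. -/
theorem aux_avg (A B C D p1 p2 p3 p4 : ℝ) (hB : 0 < B) (hAB : B ≤ A) (hC : 0 < C) (hCD : C ≤ D)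
    (h1 : 0 ≤ p1) (h2 : 0 ≤ p2) (h3 : 0 ≤ p3) (h4 : 0 ≤ p4) (hP : 0 < p1 + p2 + p3 + p4) :
    (3 * p1 * A - (p2 + p3 + p4) * B) / (p1 * A + (p2 + p3 + p4) * B)
    + (3 * p2 * A - (p1 + p3 + p4) * B) / (p2 * A + (p1 + p3 + p4) * B)
    + (3 * p3 * A - (p1 + p2 + p4) * B) / (p3 * A + (p1 + p2 + p4) * B)
    + (3 * p4 * A - (p1 + p2 + p3) * B) / (p4 * A + (p1 + p2 + p3) * B)
    + (-3 * p1 * C + (p2 + p3 + p4) * D) / (p1 * C + (p2 + p3 + p4) * D)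
    + (-3 * p2 * C + (p1 + p3 + p4) * D) / (p2 * C + (p1 + p3 + p4) * D)
    + (-3 * p3 * C + (p1 + p2 + p4) * D) / (p3 * C + (p1 + p2 + p4) * D)
    + (-3 * p4 * C + (p1 + p2 + p3) * D) / (p4 * C + (p1 + p2 + p3) * D)
    ≤ 12 * ((A - B) / (A + 3 * B) + (D - C) / (3 * D + C)) := by
  have e2 : p2 + (p1 + p3 + p4) = p1 + (p2 + p3 + p4) := by ring
  have e3 : p3 + (p1 + p2 + p4) = p1 + (p2 + p3 + p4) := by ring
  have e4 : p4 + (p1 + p2 + p3) = p1 + (p2 + p3 + p4) := by ring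
  have u1 := aux_unfr A B p1 (p2 + p3 + p4) hB hAB h1 (by positivity) (by linarith)
  have u2 := aux_unfr A B p2 (p1 + p3 + p4) hB hAB h2 (by positivity) (by linarith)
  have u3 := aux_unfr A B p3 (p1 + p2 + p4) hB hAB h3 (by positivity) (by linarith)
  have u4 := aux_unfr A B p4 (p1 + p2 + p3) hB hAB h4 (by positivity) (by linarith)
  have v1 := aux_fr C D p1 (p2 + p3 + p4) hC hCD h1 (by positivity) (by linarith)
  have v2 := aux_fr C D p2 (p1 + p3 + p4) hC hCD h2 (by positivity) (by linarith)
  have v3 := aux_fr C D p3 (p1 + p2 + p4) hC hCD h3 (by positivity) (by linarith)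
  have v4 := aux_fr C D p4 (p1 + p2 + p3) hC hCD h4 (by positivity) (by linarith)
  rw [e2] at u2 v2
  rw [e3] at u3 v3
  rw [e4] at u4 v4
  have z : (3 * p1 - (p2 + p3 + p4)) / (p1 + (p2 + p3 + p4))
      + (3 * p2 - (p1 + p3 + p4)) / (p1 + (p2 + p3 + p4))
      + (3 * p3 - (p1 + p2 + p4)) / (p1 + (p2 + p3 + p4))
      + (3 * p4 - (p1 + p2 + p3)) / (p1 + (p2 + p3 + p4)) = 0 := by
    rw [← add_div, ← add_div, ← add_div]
    apply div_eq_zero_iff.2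
    left
    ring
  have z1 := congrArg (fun t => 16 * A * B / (A + 3 * B) ^ 2 * t) z
  have z2 := congrArg (fun t => 16 * C * D / (3 * D + C) ^ 2 * t) z
  simp only [mul_add, mul_zero] at z1 z2
  linarith

theorem aux_spin (b : Bool) : spin b * spin b = 1 := by cases b <;> simp [spin]

theorem aux_energy {V : Type*} [Fintype V] [DecidableEq V] (J1 J2 J3 : ℝ) (X Y T : Finset V)
    (hXY : X ≠ Y) (hYT : Y ≠ T) (hTX : T ≠ X) (J R : Finset V → ℝ)
    (h1 : J X = J1) (h2 : J Y = J2) (h3 : J T = J3)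
    (hR : ∀ B, B ≠ X → B ≠ Y → B ≠ T → J B = R B) (f : Finset V → ℝ) :
    ∑ B, J B * f B = ∑ B, (if B = X ∨ B = Y ∨ B = T then 0 else R B) * f B
      + (J1 * f X + J2 * f Y + J3 * f T) := by
  have : ∀ B, J B * f B = (if B = X ∨ B = Y ∨ B = T then 0 else R B) * f B
      + ((if B = X then J1 * f B else 0) + (if B = Y then J2 * f B else 0)
      + (if B = T then J3 * f B else 0)) := by
    intro B
    by_cases hX : B = X
    · subst hX; simp [hXY, hTX.symm, h1]
    by_cases hY : B = Y
    · subst hY; simp [hX, hYT, h2]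
    by_cases hT : B = T
    · subst hT; simp [hX, hY, h3]
    simp [hX, hY, hT, hR]
  rw [Finset.sum_congr rfl (fun B _ => this B)]
  simp [Finset.sum_add_distrib]

/-- for a triangle with i.i.d. symmetric `±J` couplings inside
an arbitrary finite Ising system, the average triangle energy (over the 8
equiprobable sign configurations) is at least the average of the isolated
unfrustrated and frustrated triangle energies. -/
theorem triangle_average_energy_bound {V : Type*} [Fintype V] [DecidableEq V]
    (β J0 : ℝ) (hβ : 0 < β) (hJ : 0 < J0) (a b c : V)
    (hab : a ≠ b) (hbc : b ≠ c) (hca : c ≠ a)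
    (K : (Fin 3 → Bool) → Finset V → ℝ)
    (hKab : ∀ ε, K ε {a, b} = spin (ε 0) * J0)
    (hKbc : ∀ ε, K ε {b, c} = spin (ε 1) * J0)
    (hKca : ∀ ε, K ε {c, a} = spin (ε 2) * J0)
    (hoff : ∀ ε ε', ∀ B : Finset V,
      B ≠ {a, b} → B ≠ {b, c} → B ≠ {c, a} → K ε B = K ε' B) :
    (1 / 8) * ∑ ε : Fin 3 → Bool,
        (eA β (K ε) {a, b} + eA β (K ε) {b, c} + eA β (K ε) {c, a}) ≥
      -(3 / 2) * J0 *
        ((Real.exp (2 * β * J0) - Real.exp (-(2 * β * J0))) /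
            (Real.exp (2 * β * J0) + 3 * Real.exp (-(2 * β * J0))) +
          (Real.exp (2 * β * J0) - Real.exp (-(2 * β * J0))) /
            (3 * Real.exp (2 * β * J0) + Real.exp (-(2 * β * J0)))) := by
  have hsab : ({a, b} : Finset V) ≠ {b, c} := by
    intro h
    have : a ∈ ({b, c} : Finset V) := h ▸ (by simp)
    simp only [Finset.mem_insert, Finset.mem_singleton] at this
    rcases this with h | h
    · exact hab h
    · exact hca h.symm
  have hsbc : ({b, c} : Finset V) ≠ {c, a} := by
    intro h
    have : b ∈ ({c, a} : Finset V) := h ▸ (by simp)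
    simp only [Finset.mem_insert, Finset.mem_singleton] at this
    rcases this with h | h
    · exact hbc h
    · exact hab h.symm
  have hsca : ({c, a} : Finset V) ≠ {a, b} := by
    intro h
    have : c ∈ ({a, b} : Finset V) := h ▸ (by simp)
    simp only [Finset.mem_insert, Finset.mem_singleton] at this
    rcases this with h | h
    · exact hca h
    · exact hbc h.symm
  obtain ⟨w, hw, hwS⟩ : ∃ w : (V → Bool) → ℝ, (∀ S, 0 < w S) ∧ ∀ ε S,
      Real.exp (-β * energy (K ε) S) = Real.exp (β * J0 * (spin (ε 0) * (spin (S a) * spin (S b))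
        + spin (ε 1) * (spin (S b) * spin (S c))
        + spin (ε 2) * ((spin (S a) * spin (S b)) * (spin (S b) * spin (S c))))) * w S := by
    refine ⟨fun S => Real.exp (β * ∑ B : Finset V,
      (if B = {a, b} ∨ B = {b, c} ∨ B = {c, a} then 0 else K (fun _ => true) B)
        * ∏ i ∈ B, spin (S i)), fun S => Real.exp_pos _, fun ε S => ?_⟩
    rw [← Real.exp_add]
    congr 1
    unfold energy
    rw [aux_energy _ _ _ {a, b} {b, c} {c, a} hsab hsbc hsca (K ε) (K (fun _ => true))
      (hKab ε) (hKbc ε) (hKca ε) (fun B x y z => hoff _ _ B x y z),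
      Finset.prod_pair hab, Finset.prod_pair hbc, Finset.prod_pair hca]
    have := aux_spin (S b)
    linear_combination (-β * J0 * spin (ε 2) * spin (S a) * spin (S c)) * this
  obtain ⟨p1, p2, p3, p4, h1, h2, h3, h4, hP, hdec⟩ : ∃ p1 p2 p3 p4 : ℝ, 0 ≤ p1 ∧ 0 ≤ p2 ∧ 0 ≤ p3
      ∧ 0 ≤ p4 ∧ 0 < p1 + p2 + p3 + p4 ∧ ∀ G : ℝ → ℝ → ℝ,
      ∑ S : V → Bool, G (spin (S a) * spin (S b)) (spin (S b) * spin (S c)) * w S =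
        G 1 1 * p1 + G 1 (-1) * p2 + G (-1) 1 * p3 + G (-1) (-1) * p4 := by
    have hnn : ∀ u v : ℝ, 0 ≤ ∑ S : V → Bool,
        (if spin (S a) * spin (S b) = u ∧ spin (S b) * spin (S c) = v then w S else 0) := by
      intro u v
      refine Finset.sum_nonneg fun S _ => ?_
      split_ifs
      · exact (hw S).le
      · exact le_rfl
    have hd : ∀ G : ℝ → ℝ → ℝ,
        ∑ S : V → Bool, G (spin (S a) * spin (S b)) (spin (S b) * spin (S c)) * w S =
        G 1 1 * ∑ S : V → Bool,
          (if spin (S a) * spin (S b) = 1 ∧ spin (S b) * spin (S c) = 1 then w S else 0)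
        + G 1 (-1) * ∑ S : V → Bool,
          (if spin (S a) * spin (S b) = 1 ∧ spin (S b) * spin (S c) = -1 then w S else 0)
        + G (-1) 1 * ∑ S : V → Bool,
          (if spin (S a) * spin (S b) = -1 ∧ spin (S b) * spin (S c) = 1 then w S else 0)
        + G (-1) (-1) * ∑ S : V → Bool,
          (if spin (S a) * spin (S b) = -1 ∧ spin (S b) * spin (S c) = -1 then w S else 0) := by
      intro G
      simp only [Finset.mul_sum, ← Finset.sum_add_distrib]
      refine Finset.sum_congr rfl fun S _ => ?_
      cases S a <;> cases S b <;> cases S c <;> norm_num [spin]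
    refine ⟨_, _, _, _, hnn 1 1, hnn 1 (-1), hnn (-1) 1, hnn (-1) (-1), ?_, hd⟩
    have := hd (fun _ _ => 1)
    simp only [one_mul] at this
    rw [← this]
    exact Finset.sum_pos (fun S _ => hw S) Finset.univ_nonempty
  obtain ⟨G1, hG1⟩ : ∃ G1 : (Fin 3 → Bool) → ℝ → ℝ → ℝ, ∀ ε x y, G1 ε x y =
      Real.exp (β * J0 * (spin (ε 0) * x + spin (ε 1) * y + spin (ε 2) * (x * y))) :=
    ⟨_, fun _ _ _ => rfl⟩
  obtain ⟨G2, hG2⟩ : ∃ G2 : (Fin 3 → Bool) → ℝ → ℝ → ℝ, ∀ ε x y, G2 ε x y =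
      (spin (ε 0) * x + spin (ε 1) * y + spin (ε 2) * (x * y)) *
      Real.exp (β * J0 * (spin (ε 0) * x + spin (ε 1) * y + spin (ε 2) * (x * y))) :=
    ⟨_, fun _ _ _ => rfl⟩
  have htot : ∀ ε : Fin 3 → Bool,
      eA β (K ε) {a, b} + eA β (K ε) {b, c} + eA β (K ε) {c, a} =
      -J0 * ((G2 ε 1 1 * p1 + G2 ε 1 (-1) * p2 + G2 ε (-1) 1 * p3 + G2 ε (-1) (-1) * p4) /
        (G1 ε 1 1 * p1 + G1 ε 1 (-1) * p2 + G1 ε (-1) 1 * p3 + G1 ε (-1) (-1) * p4)) := by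
    intro ε
    rw [← hdec (G2 ε), ← hdec (G1 ε)]
    simp only [hG1, hG2]
    unfold eA texp Z
    simp only [hwS, hKab, hKbc, hKca, Finset.prod_pair hab, Finset.prod_pair hbc,
      Finset.prod_pair hca]
    rw [← add_div, ← add_div, ← mul_div_assoc, ← Finset.sum_add_distrib, ← Finset.sum_add_distrib,
      Finset.mul_sum]
    congr 1
    refine Finset.sum_congr rfl fun S _ => ?_
    generalize Real.exp _ = E
    have := aux_spin (S b)
    linear_combination (J0 * spin (ε 2) * spin (S a) * spin (S c) * E * w S) * this
  have ht : 0 < β * J0 := mul_pos hβ hJ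
  have havg := aux_avg (Real.exp (β * J0 * 3)) (Real.exp (β * J0 * (-1)))
    (Real.exp (β * J0 * (-3))) (Real.exp (β * J0 * 1)) p1 p2 p3 p4 (Real.exp_pos _)
    (Real.exp_le_exp.2 (by linarith)) (Real.exp_pos _) (Real.exp_le_exp.2 (by linarith))
    h1 h2 h3 h4 hP
  have r1 : (Real.exp (2 * β * J0) - Real.exp (-(2 * β * J0))) /
      (Real.exp (2 * β * J0) + 3 * Real.exp (-(2 * β * J0))) =
      (Real.exp (β * J0 * 3) - Real.exp (β * J0 * (-1))) /
      (Real.exp (β * J0 * 3) + 3 * Real.exp (β * J0 * (-1))) := by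
    have a1 : Real.exp (β * J0 * 3) = Real.exp (2 * β * J0) * Real.exp (β * J0) := by
      rw [← Real.exp_add]; congr 1; ring
    have a2 : Real.exp (β * J0 * (-1)) = Real.exp (-(2 * β * J0)) * Real.exp (β * J0) := by
      rw [← Real.exp_add]; congr 1; ring
    rw [a1, a2, ← sub_mul, ← mul_assoc, ← add_mul, mul_div_mul_right _ _ (Real.exp_pos _).ne']
  have r2 : (Real.exp (2 * β * J0) - Real.exp (-(2 * β * J0))) /
      (3 * Real.exp (2 * β * J0) + Real.exp (-(2 * β * J0))) =
      (Real.exp (β * J0 * 1) - Real.exp (β * J0 * (-3))) /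
      (3 * Real.exp (β * J0 * 1) + Real.exp (β * J0 * (-3))) := by
    have a1 : Real.exp (β * J0 * 1) = Real.exp (2 * β * J0) * Real.exp (-(β * J0)) := by
      rw [← Real.exp_add]; congr 1; ring
    have a2 : Real.exp (β * J0 * (-3)) = Real.exp (-(2 * β * J0)) * Real.exp (-(β * J0)) := by
      rw [← Real.exp_add]; congr 1; ring
    rw [a1, a2, ← sub_mul, ← mul_assoc, ← add_mul, mul_div_mul_right _ _ (Real.exp_pos _).ne']
  rw [r1, r2, aux_sum8]
  simp only [htot]
  simp only [hG1, hG2, spin, Matrix.cons_val_zero, Matrix.cons_val_one, Matrix.cons_val]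
  norm_num only [if_true, if_false, Bool.false_eq_true]
  norm_num only at havg
  generalize Real.exp (β * J0 * 3) = A at havg ⊢
  generalize Real.exp (β * J0 * (-1)) = B at havg ⊢
  generalize Real.exp (β * J0 * (-3)) = C at havg ⊢
  generalize Real.exp (β * J0 * 1) = D at havg ⊢
  rw [ge_iff_le]
  have := mul_le_mul_of_nonneg_left havg hJ.le
  linear_combination (1 / 8) * this
end
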